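/- arXiv:2306.03697 — 2 statements merged into one kernel-verified Lean document; each statement's English description precedes it below -/
import Mathlib

section
/- For every integer n ≥ 6 and every positive integer k, the number of integer vectors z ∈ ℤ^n with ‖z‖² = k is at least binomial(⌊n/2⌋ + k − 1, k). -/
section LatticeHelpers
open Finset

def sgn4 (d : ℕ) : ℤ := if d % 4 = 1 then 1 else if d % 4 = 3 then -1 else 0

def Qd (n : ℕ) : Finset (ℕ × ℕ × ℕ × ℕ) :=
  ((range (2*n+1)) ×ˢ (range (2*n+1)) ×ˢ (range (2*n+1)) ×ˢ (range (2*n+1))).filter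
    (fun q => q.1 % 2 = 1 ∧ q.2.1 % 2 = 1 ∧ q.2.2.1 % 2 = 1 ∧ q.2.2.2 % 2 = 1 ∧
      q.1 * q.2.1 + q.2.2.1 * q.2.2.2 = 2 * n)

lemma mem_Qd (n d a e b : ℕ) : (d, a, e, b) ∈ Qd n ↔
    d % 2 = 1 ∧ a % 2 = 1 ∧ e % 2 = 1 ∧ b % 2 = 1 ∧ d * a + e * b = 2 * n := by
  simp only [Qd, mem_filter, mem_product, mem_range]
  constructor
  · rintro ⟨_, h⟩; exact h
  · intro h
    refine ⟨?_, h⟩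
    obtain ⟨h1, h2, h3, h4, h5⟩ := h
    have hd : 1 ≤ d := by omega
    have ha : 1 ≤ a := by omega
    have he : 1 ≤ e := by omega
    have hb : 1 ≤ b := by omega
    refine ⟨?_, ?_, ?_, ?_⟩ <;> nlinarith

lemma sgn4_odd_mul {d e : ℕ} (hd : d % 2 = 1) (he : e % 2 = 1) :
    sgn4 d * sgn4 e = if d % 4 = e % 4 then 1 else -1 := by
  unfold sgn4
  have h1 : d % 4 = 1 ∨ d % 4 = 3 := by omega
  have h2 : e % 4 = 1 ∨ e % 4 = 3 := by omega
  rcases h1 with h1 | h1 <;> rcases h2 with h2 | h2 <;> simp [h1, h2]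

def inv4 (q : ℕ × ℕ × ℕ × ℕ) : ℕ × ℕ × ℕ × ℕ :=
  let d := q.1; let a := q.2.1; let e := q.2.2.1; let b := q.2.2.2
  let v := d / (d - e)
  ((v+1)*a + v*b, d % (d-e), v*a+(v-1)*b, (d-e) - d % (d-e))

lemma inv4_spec {n d a e b : ℕ} (hn : n % 2 = 1) (h : (d, a, e, b) ∈ Qd n) (hlt : e < d) :
    ∃ d' a' e' b', inv4 (d, a, e, b) = (d', a', e', b') ∧ (d', a', e', b') ∈ Qd n ∧ e' < d' ∧
     inv4 (d', a', e', b') = (d, a, e, b) ∧ sgn4 d * sgn4 e + sgn4 d' * sgn4 e' = 0 := by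
  rw [mem_Qd] at h
  obtain ⟨h1, h2, h3, h4, h5⟩ := h
  obtain ⟨w, hw⟩ : ∃ w, d = e + w := ⟨d - e, by omega⟩
  have hw0 : 0 < w := by omega
  have hwe : w % 2 = 0 := by omega
  obtain ⟨v, hv⟩ : ∃ v, v = d / w := ⟨_, rfl⟩
  obtain ⟨r, hr⟩ : ∃ r, r = d % w := ⟨_, rfl⟩
  have hdiv : w * v + r = d := by rw [hv, hr]; exact Nat.div_add_mod d w
  have hrw : r < w := by rw [hr]; exact Nat.mod_lt _ hw0
  have hv1 : 1 ≤ v := by rw [hv]; exact Nat.div_pos (by omega) hw0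
  obtain ⟨t, ht⟩ : ∃ t, v = t + 1 := ⟨v - 1, by omega⟩
  obtain ⟨s, hs⟩ : ∃ s, w = r + s := ⟨w - r, by omega⟩
  have hr2 : r % 2 = 1 := by
    have : (w * v) % 2 = 0 := by rw [Nat.mul_mod, hwe]; simp
    omega
  have hs2 : s % 2 = 1 := by omega
  have hdw : d - e = w := by omega
  have hinv : inv4 (d, a, e, b) = ((v+1)*a + v*b, r, v*a+t*b, s) := by
    simp only [inv4, hdw, ← hv, ← hr]
    have : v - 1 = t := by omega
    have h' : w - r = s := by omega
    rw [this, h']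
  have hdiff : (v+1)*a + v*b = (v*a+t*b) + (a + b) := by rw [ht]; ring
  have hab : (a + b) % 2 = 0 := by omega
  have hsum : ((v+1)*a + v*b) * r + (v*a+t*b) * s = 2 * n := by
    have e1 : e = w * t + r := by
      have : e + w = w * t + w + r := by rw [← hw, ← hdiv, ht]; ring
      omega
    rw [← h5, hw, e1, ht, hs]; ring
  have hd'2 : ((v+1)*a + v*b) % 2 = 1 := by
    have : (v+1)*a + v*b = v * (a + b) + a := by ring
    have h' : (v * (a+b)) % 2 = 0 := by rw [Nat.mul_mod, hab]; simp
    omega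
  have he'2 : (v*a+t*b) % 2 = 1 := by omega
  refine ⟨_, _, _, _, hinv, ?_, ?_, ?_, ?_⟩
  · rw [mem_Qd]; exact ⟨hd'2, hr2, he'2, hs2, hsum⟩
  · omega
  · have hsub : (v+1)*a + v*b - (v*a+t*b) = a + b := by omega
    have hq : (v+1)*a + v*b = a + (a + b) * v := by ring
    have hq1 : ((v+1)*a + v*b) / (a + b) = v := by
      rw [hq, Nat.add_mul_div_left _ _ (by omega), Nat.div_eq_of_lt (by omega)]; simp
    have hq2 : ((v+1)*a + v*b) % (a + b) = a := by
      rw [hq, Nat.add_mul_mod_self_left, Nat.mod_eq_of_lt (by omega)]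
    simp only [inv4, hsub, hq1, hq2]
    have e1 : e = w * t + r := by
      have : e + w = w * t + w + r := by rw [← hw, ← hdiv, ht]; ring
      omega
    have e2 : v - 1 = t := by omega
    rw [e2]
    refine Prod.ext ?_ (Prod.ext rfl (Prod.ext ?_ ?_))
    · simp only; rw [← hdiv, hs]; ring
    · simp only; rw [e1, hs, ht]; ring
    · simp only; omega
  · rw [sgn4_odd_mul h1 h3, sgn4_odd_mul hd'2 he'2, hdiff]
    have key : (d % 4 = e % 4) ↔ ¬ ((v*a+t*b + (a+b)) % 4 = (v*a+t*b) % 4) := by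
      have k1 : (d % 4 = e % 4) ↔ w % 4 = 0 := by omega
      have k2 : ((v*a+t*b + (a+b)) % 4 = (v*a+t*b) % 4) ↔ (a + b) % 4 = 0 := by omega
      rw [k1, k2]
      have h6 : (e * (a + b) + w * a) % 4 = 2 := by
        have : e * (a + b) + w * a = 2 * n := by rw [← h5, hw]; ring
        omega
      have c1 : e % 4 = 1 ∨ e % 4 = 3 := by omega
      have c2 : a % 4 = 1 ∨ a % 4 = 3 := by omega
      have c3 : w % 4 = 0 ∨ w % 4 = 2 := by omega
      have c4 : (a + b) % 4 = 0 ∨ (a+b) % 4 = 2 := by omega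
      rw [Nat.add_mod, Nat.mul_mod, Nat.mul_mod w] at h6
      rcases c1 with c1 | c1 <;> rcases c2 with c2 | c2 <;> rcases c3 with c3 | c3 <;>
        rcases c4 with c4 | c4 <;> rw [c1, c2, c3, c4] at h6 <;> omega
    by_cases hc : d % 4 = e % 4
    · rw [if_pos hc, if_neg (key.1 hc)]; norm_num
    · rw [if_neg hc, if_pos (by by_contra h'; exact hc (key.2 h'))]; norm_num

lemma sum_gt {n : ℕ} (hn : n % 2 = 1) :
    ∑ q ∈ (Qd n).filter (fun q => q.2.2.1 < q.1), sgn4 q.1 * sgn4 q.2.2.1 = 0 := by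
  refine Finset.sum_involution (fun q _ => inv4 q) ?_ ?_ ?_ ?_
  · rintro ⟨d, a, e, b⟩ h
    rw [mem_filter] at h
    obtain ⟨d', a', e', b', h1, h2, h3, h4, h5⟩ := inv4_spec hn h.1 h.2
    simp only [h1]; exact h5
  · rintro ⟨d, a, e, b⟩ h hne heq
    rw [mem_filter] at h
    obtain ⟨d', a', e', b', h1, h2, h3, h4, h5⟩ := inv4_spec hn h.1 h.2
    simp only [h1, Prod.mk.injEq] at heq
    obtain ⟨rfl, -, rfl, -⟩ := heq
    simp only at hne
    omega
  · rintro ⟨d, a, e, b⟩ h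
    rw [mem_filter] at h
    obtain ⟨d', a', e', b', h1, h2, h3, h4, h5⟩ := inv4_spec hn h.1 h.2
    simp only [h1, mem_filter]; exact ⟨h2, h3⟩
  · rintro ⟨d, a, e, b⟩ h
    rw [mem_filter] at h
    obtain ⟨d', a', e', b', h1, h2, h3, h4, h5⟩ := inv4_spec hn h.1 h.2
    simp only [h1, h4]

lemma sum_lt {n : ℕ} (hn : n % 2 = 1) :
    ∑ q ∈ (Qd n).filter (fun q => q.1 < q.2.2.1), sgn4 q.1 * sgn4 q.2.2.1 = 0 := by
  rw [← sum_gt hn]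
  refine Finset.sum_nbij' (fun q => (q.2.2.1, q.2.2.2, q.1, q.2.1))
    (fun q => (q.2.2.1, q.2.2.2, q.1, q.2.1)) ?_ ?_ ?_ ?_ ?_
  · rintro ⟨d, a, e, b⟩ h
    simp only [mem_filter, mem_Qd] at h ⊢
    omega
  · rintro ⟨d, a, e, b⟩ h
    simp only [mem_filter, mem_Qd] at h ⊢
    omega
  · rintro ⟨d, a, e, b⟩ h; rfl
  · rintro ⟨d, a, e, b⟩ h; rfl
  · rintro ⟨d, a, e, b⟩ h; simp only; ring

lemma key_sum {n : ℕ} (hn : n % 2 = 1) :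
    (n : ℤ) ≤ ∑ q ∈ Qd n, sgn4 q.1 * sgn4 q.2.2.1 := by
  rw [← Finset.sum_filter_add_sum_filter_not _ (fun q => q.2.2.1 < q.1), sum_gt hn,
    ← Finset.sum_filter_add_sum_filter_not _ (fun q => q.1 < q.2.2.1), filter_filter,
    filter_filter]
  have e1 : (Qd n).filter (fun q => ¬ q.2.2.1 < q.1 ∧ q.1 < q.2.2.1) =
      (Qd n).filter (fun q => q.1 < q.2.2.1) := by
    apply filter_congr; intro q _; omega
  rw [e1, sum_lt hn]
  have e2 : ∀ q ∈ (Qd n).filter (fun q => ¬ q.2.2.1 < q.1 ∧ ¬ q.1 < q.2.2.1),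
      sgn4 q.1 * sgn4 q.2.2.1 = 1 := by
    rintro ⟨d, a, e, b⟩ h
    simp only [mem_filter, mem_Qd] at h
    obtain ⟨h, h'⟩ := h
    obtain rfl : d = e := by omega
    simp only
    rw [sgn4_odd_mul h.1 h.1]; simp
  rw [Finset.sum_congr rfl e2]
  simp only [sum_const, nsmul_eq_mul, mul_one, zero_add, Nat.cast_le]
  calc n = (range n).card := by simp
    _ ≤ _ := by
      refine Finset.card_le_card_of_injOn (fun i => (1, 2*i+1, 1, 2*n-(2*i+1))) ?_ ?_
      · intro i hi
        have hi' : i < n := by simpa using hi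
        simp only [mem_coe, mem_filter, mem_Qd]
        refine ⟨⟨trivial, by omega, trivial, by omega, by omega⟩, by omega, by omega⟩
      · intro i _ j _ h
        simp only [Prod.mk.injEq] at h
        omega

lemma sgn4_mul (d e : ℕ) : sgn4 (d * e) = sgn4 d * sgn4 e := by
  unfold sgn4
  rw [Nat.mul_mod]
  have h1 : d % 4 < 4 := Nat.mod_lt _ (by norm_num)
  have h2 : e % 4 < 4 := Nat.mod_lt _ (by norm_num)
  generalize d % 4 = x at *
  generalize e % 4 = y at *
  interval_cases x <;> interval_cases y <;> simp

lemma sgn4_pow (d k : ℕ) : sgn4 (d ^ k) = sgn4 d ^ k := by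
  induction k with
  | zero => simp [sgn4]
  | succ k ih => rw [pow_succ, sgn4_mul, ih, pow_succ]

def sgnF : ArithmeticFunction ℤ := ⟨sgn4, by simp [sgn4]⟩

def fsum (u : ℕ) : ℤ := ∑ d ∈ u.divisors, sgn4 d

lemma fsum_mul {u v : ℕ} (h : u.Coprime v) : fsum (u * v) = fsum u * fsum v := by
  have hm : ArithmeticFunction.IsMultiplicative sgnF :=
    ⟨by simp [sgnF, sgn4], fun {m n} _ => by simp [sgnF, sgn4_mul]⟩
  have := (hm.mul ArithmeticFunction.isMultiplicative_zeta.natCast).map_mul_of_coprime h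
  simp only [ArithmeticFunction.coe_mul_zeta_apply] at this
  exact this

def Primary (z : GaussianInt) : Prop := z.im % 2 = 0 ∧ (z.re + z.im) % 4 = 1

instance : DecidablePred Primary := fun z => by unfold Primary; infer_instance

noncomputable def Pr (u : ℕ) : Finset GaussianInt :=
  (((Icc (-(u:ℤ)) u) ×ˢ (Icc (-(u:ℤ)) u)).image (fun p => (⟨p.1, p.2⟩ : GaussianInt))).filter
    (fun z => z.norm = u ∧ Primary z)

lemma mem_Pr {u : ℕ} {z : GaussianInt} : z ∈ Pr u ↔ z.norm = u ∧ Primary z := by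
  simp only [Pr, mem_filter, mem_image, mem_product, mem_Icc, Prod.exists, and_iff_right_iff_imp]
  rintro ⟨h, -⟩
  refine ⟨z.re, z.im, ?_, rfl⟩
  rw [Zsqrtd.norm_def] at h
  refine ⟨⟨?_, ?_⟩, ?_, ?_⟩ <;> nlinarith [sq_nonneg z.re, sq_nonneg z.im, sq_nonneg (z.re+1), sq_nonneg (z.re-1), sq_nonneg (z.im+1), sq_nonneg (z.im-1)]

lemma primary_mul {z w : GaussianInt} (hz : Primary z) (hw : Primary w) : Primary (z * w) := by
  obtain ⟨h1, h2⟩ := hz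
  obtain ⟨h3, h4⟩ := hw
  obtain ⟨y, hy⟩ : ∃ y, z.im = 2 * y := ⟨z.im / 2, by omega⟩
  obtain ⟨y', hy'⟩ : ∃ y, w.im = 2 * y := ⟨w.im / 2, by omega⟩
  obtain ⟨x, hx⟩ : ∃ x, z.re = 4 * x + 1 - z.im := ⟨(z.re + z.im) / 4, by omega⟩
  obtain ⟨x', hx'⟩ : ∃ x, w.re = 4 * x + 1 - w.im := ⟨(w.re + w.im) / 4, by omega⟩
  rw [hy] at hx
  rw [hy'] at hx'
  constructor
  · rw [Zsqrtd.im_mul, hy, hy']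
    have : z.re * (2 * y') + 2 * y * w.re = 2 * (z.re * y' + y * w.re) := by ring
    omega
  · rw [Zsqrtd.im_mul, Zsqrtd.re_mul, hy, hy', hx, hx']
    ring_nf
    omega

lemma primary_one : Primary 1 := by constructor <;> simp

lemma primary_pow {z : GaussianInt} (hz : Primary z) (k : ℕ) : Primary (z ^ k) := by
  induction k with
  | zero => simpa using primary_one
  | succ k ih => rw [pow_succ]; exact primary_mul ih hz

lemma primary_star {z : GaussianInt} (hz : Primary z) : Primary (star z) := by
  obtain ⟨h1, h2⟩ := hz
  constructor
  · rw [Zsqrtd.im_star]; omega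
  · rw [Zsqrtd.im_star, Zsqrtd.re_star]; omega

lemma primary_assoc {z w : GaussianInt} (hz : Primary z) (hw : Primary w) (h : Associated z w) : z = w := by
  obtain ⟨u, rfl⟩ := h
  have hu := (Zsqrtd.norm_eq_one_iff' (by norm_num) (u : GaussianInt)).2 u.isUnit
  generalize (u : GaussianInt) = t at *
  rw [Zsqrtd.norm_def] at hu
  obtain ⟨h1, h2⟩ := hz
  obtain ⟨h3, h4⟩ := hw
  rw [Zsqrtd.im_mul] at h3 h4
  rw [Zsqrtd.re_mul] at h4
  have a1 : t.re ≤ 1 := by nlinarith [sq_nonneg t.im]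
  have a2 : -1 ≤ t.re := by nlinarith [sq_nonneg t.im]
  have a3 : t.im ≤ 1 := by nlinarith [sq_nonneg t.re]
  have a4 : -1 ≤ t.im := by nlinarith [sq_nonneg t.re]
  have : t = 1 := by
    obtain ⟨a, b⟩ := t
    simp only at *
    have ha : a = -1 ∨ a = 0 ∨ a = 1 := by omega
    have hb : b = -1 ∨ b = 0 ∨ b = 1 := by omega
    rcases ha with rfl | rfl | rfl <;> rcases hb with rfl | rfl | rfl <;> norm_num at * <;>
      first | rfl | omega
  rw [this, mul_one]

lemma isCoprime_of_norm {z w : GaussianInt} {u v : ℕ} (hz : z.norm = u) (hw : w.norm = v)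
    (h : u.Coprime v) : IsCoprime z w := by
  have h1 : IsCoprime (u : ℤ) (v : ℤ) := Nat.isCoprime_iff_coprime.2 h
  obtain ⟨a, b, hab⟩ := h1
  refine ⟨a * star z, b * star w, ?_⟩
  have e1 : (z.norm : GaussianInt) = z * star z := Zsqrtd.norm_eq_mul_conj z
  have e2 : (w.norm : GaussianInt) = w * star w := Zsqrtd.norm_eq_mul_conj w
  calc (a:GaussianInt) * star z * z + b * star w * w = a * (z * star z) + b * (w * star w) := by ring
    _ = ((a * u + b * v : ℤ) : GaussianInt) := by rw [← e1, ← e2, hz, hw]; push_cast; ring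
    _ = 1 := by rw [hab]; simp

lemma card_Pr_mul {u v : ℕ} (h : u.Coprime v) :
    (Pr u).card * (Pr v).card ≤ (Pr (u * v)).card := by
  rw [← card_product]
  refine card_le_card_of_injOn (fun p => p.1 * p.2) ?_ ?_
  · rintro ⟨z, w⟩ hp
    rw [mem_coe, mem_product, mem_Pr, mem_Pr] at hp
    rw [mem_coe, mem_Pr]
    refine ⟨?_, primary_mul hp.1.2 hp.2.2⟩
    rw [Zsqrtd.norm_mul, hp.1.1, hp.2.1]; push_cast; rfl
  · rintro ⟨z, w⟩ hp ⟨z', w'⟩ hp' heq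
    rw [mem_coe, mem_product, mem_Pr, mem_Pr] at hp hp'
    simp only at hp hp' heq
    have c1 : z ∣ z' := (isCoprime_of_norm hp.1.1 hp'.2.1 h).dvd_of_dvd_mul_right
      (heq ▸ dvd_mul_right z w)
    have c2 : z' ∣ z := (isCoprime_of_norm hp'.1.1 hp.2.1 h).dvd_of_dvd_mul_right
      (heq ▸ dvd_mul_right z' w')
    have c3 : w ∣ w' := (isCoprime_of_norm hp'.1.1 hp.2.1 h).symm.dvd_of_dvd_mul_left
      (heq ▸ dvd_mul_left w z)
    have c4 : w' ∣ w := (isCoprime_of_norm hp.1.1 hp'.2.1 h).symm.dvd_of_dvd_mul_left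
      (heq ▸ dvd_mul_left w' z')
    rw [primary_assoc hp.1.2 hp'.1.2 (associated_of_dvd_dvd c1 c2),
      primary_assoc hp.2.2 hp'.2.2 (associated_of_dvd_dvd c3 c4)]

lemma norm_pow' (z : GaussianInt) (k : ℕ) : (z ^ k).norm = z.norm ^ k := by
  induction k with
  | zero => simp
  | succ k ih => rw [pow_succ, Zsqrtd.norm_mul, ih, pow_succ]

lemma exists_primary_prime {p : ℕ} (hp : p.Prime) (h1 : p % 4 = 1) :
    ∃ z : GaussianInt, z.norm = p ∧ Primary z := by
  have := Fact.mk hp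
  obtain ⟨a, b, hab⟩ := Nat.Prime.sq_add_sq (p := p) (by omega)
  have key : ∀ x y : ℕ, x ^ 2 + y ^ 2 = p → y % 2 = 0 → ∃ z : GaussianInt, z.norm = p ∧ Primary z := by
    intro x y hxy hy
    have hx : x % 2 = 1 := by
      by_contra hx
      have e1 : x ^ 2 % 2 = 0 := by rw [Nat.pow_mod]; simp [show x % 2 = 0 by omega]
      have e2 : y ^ 2 % 2 = 0 := by rw [Nat.pow_mod]; simp [hy]
      omega
    have hc : (x + y) % 4 = 1 ∨ (x + y) % 4 = 3 := by omega
    have hxy' : (x:ℤ)^2 + (y:ℤ)^2 = p := by exact_mod_cast hxy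
    rcases hc with hc | hc
    · refine ⟨⟨x, y⟩, ?_, ?_, ?_⟩
      · rw [Zsqrtd.norm_def]; simp only; linarith
      · simp only; omega
      · simp only; omega
    · refine ⟨⟨-x, -y⟩, ?_, ?_, ?_⟩
      · rw [Zsqrtd.norm_def]; simp only; linarith
      · simp only; omega
      · simp only; omega
  by_cases hb : b % 2 = 0
  · exact key a b hab hb
  · refine key b a (by omega) ?_
    by_contra ha
    have e1 : a ^ 2 % 2 = 1 := by rw [Nat.pow_mod]; simp [show a % 2 = 1 by omega]
    have e2 : b ^ 2 % 2 = 1 := by rw [Nat.pow_mod]; simp [show b % 2 = 1 by omega]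
    omega

lemma coprime_star {p : ℕ} (hp : p.Prime) (h1 : p % 4 = 1) {z : GaussianInt} (hz : z.norm = p) :
    IsCoprime z (star z) := by
  have hre : IsCoprime (2 * z.re) (p : ℤ) := by
    have hp' : Prime (p : ℤ) := Nat.prime_iff_prime_int.1 hp
    refine IsCoprime.symm ((Prime.coprime_iff_not_dvd hp').2 ?_)
    intro hd
    have hd' : (p : ℤ) ∣ z.re := by
      rcases hp'.dvd_or_dvd hd with h | h
      · exfalso
        have := Int.le_of_dvd (by norm_num) h
        have := hp.two_le
        omega
      · exact h
    rw [Zsqrtd.norm_def] at hz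
    have h2 : (2:ℤ) ≤ p := by exact_mod_cast hp.two_le
    by_cases h0 : z.re = 0
    · rw [h0] at hz
      have hz' : (p:ℤ) = z.im * z.im := by linarith
      have hu := hp'.irreducible.isUnit_or_isUnit hz'
      have : z.im * z.im = 1 := by
        rcases hu with hu | hu <;> rcases Int.isUnit_iff.1 hu with hu | hu <;> rw [hu] <;> norm_num
      omega
    · have := Int.le_of_dvd (abs_pos.2 h0) ((dvd_abs _ _).2 hd')
      have h3 : |z.re| * |z.re| = z.re * z.re := abs_mul_abs_self _
      nlinarith [mul_self_nonneg z.im]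
  obtain ⟨a, b, hab⟩ := hre
  refine ⟨a + b * star z, a, ?_⟩
  have e1 : (z.norm : GaussianInt) = z * star z := Zsqrtd.norm_eq_mul_conj z
  have e2 : z + star z = ((2 * z.re : ℤ) : GaussianInt) := by
    apply Zsqrtd.ext
    · simp; ring
    · simp
  calc ((a:GaussianInt) + b * star z) * z + a * star z = a * (z + star z) + b * (z * star z) := by ring
    _ = ((a * (2 * z.re) + b * p : ℤ) : GaussianInt) := by rw [← e1, e2, hz]; push_cast; ring
    _ = 1 := by rw [hab]; simp

lemma card_Pr_pow_one {p : ℕ} (hp : p.Prime) (h1 : p % 4 = 1) (k : ℕ) :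
    k + 1 ≤ (Pr (p ^ k)).card := by
  obtain ⟨z, hz, hpr⟩ := exists_primary_prime hp h1
  have hcop := coprime_star hp h1 hz
  have hnu : ¬ IsUnit z := by
    rw [← Zsqrtd.norm_eq_one_iff' (by norm_num), hz]
    have := hp.two_le
    intro h
    norm_cast at h
    omega
  have hdiv : ∀ i j, i ≤ k → j ≤ k → z ^ i * star z ^ (k - i) = z ^ j * star z ^ (k - j) →
      i ≤ j := by
    intro i j hi hj h
    have h' : z ^ i ∣ z ^ j :=
      (IsCoprime.pow (m := i) (n := k - j) hcop).dvd_of_dvd_mul_right (h ▸ dvd_mul_right _ _)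
    refine (pow_dvd_pow_iff ?_ hnu).1 h'
    rintro rfl
    rw [Zsqrtd.norm_zero] at hz
    have := hp.pos
    omega
  calc k + 1 = (range (k+1)).card := by simp
    _ ≤ _ := by
      refine card_le_card_of_injOn (fun i => z ^ i * star z ^ (k - i)) ?_ ?_
      · intro i hi
        have hi' : i < k + 1 := by simpa using hi
        rw [mem_coe, mem_Pr]
        refine ⟨?_, primary_mul (primary_pow hpr _) (primary_pow (primary_star hpr) _)⟩
        rw [Zsqrtd.norm_mul, norm_pow', norm_pow', Zsqrtd.norm_conj, hz, ← pow_add]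
        push_cast
        congr 1; omega
      · intro i hi j hj h
        have hi' : i < k + 1 := by simpa using hi
        have hj' : j < k + 1 := by simpa using hj
        exact le_antisymm (hdiv i j (by omega) (by omega) h)
          (hdiv j i (by omega) (by omega) h.symm)

lemma fsum_le (u : ℕ) (hu : u % 2 = 1) : 0 ≤ fsum u ∧ fsum u ≤ (Pr u).card := by
  induction u using Nat.recOnPosPrimePosCoprime with
  | zero => simp at hu
  | one =>
    have : (1 : GaussianInt) ∈ Pr 1 := mem_Pr.2 ⟨by simp, primary_one⟩
    have h2 : 0 < (Pr 1).card := card_pos.2 ⟨_, this⟩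
    simp only [fsum, Nat.divisors_one, sum_singleton]
    have : sgn4 1 = 1 := by simp [sgn4]
    omega
  | prime_pow p k hp hk =>
    have hpo : p % 2 = 1 := by
      by_contra h
      have : p ^ k % 2 = 0 := by
        rw [Nat.pow_mod, show p % 2 = 0 by omega, zero_pow (by omega)]; rfl
      omega
    rw [fsum, Nat.sum_divisors_prime_pow hp]
    simp only [sgn4_pow]
    have hc : p % 4 = 1 ∨ p % 4 = 3 := by omega
    rcases hc with hc | hc
    · have : sgn4 p = 1 := by simp [sgn4, hc]
      rw [this]
      simp only [one_pow, sum_const, card_range, nsmul_eq_mul, mul_one]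
      exact ⟨by positivity, by exact_mod_cast card_Pr_pow_one hp hc k⟩
    · have : sgn4 p = -1 := by simp [sgn4, hc]
      rw [this, neg_one_geom_sum]
      split_ifs with he
      · exact ⟨le_rfl, by positivity⟩
      · rw [Nat.even_add_one, not_not] at he
        obtain ⟨m, rfl⟩ := he
        have hm : ((-(p:ℤ) : ℤ) : GaussianInt) ^ m ∈ Pr (p ^ (m + m)) := by
          rw [mem_Pr]
          constructor
          · rw [norm_pow', Zsqrtd.norm_intCast]; push_cast; ring
          · apply primary_pow
            constructor
            · rw [Zsqrtd.im_intCast]; rfl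
            · rw [Zsqrtd.im_intCast, Zsqrtd.re_intCast]; omega
        have : 0 < (Pr (p ^ (m+m))).card := card_pos.2 ⟨_, hm⟩
        omega
  | coprime a b ha hb hab iha ihb =>
    have ⟨h1, h2⟩ : a % 2 = 1 ∧ b % 2 = 1 := by
      rw [← Nat.odd_iff, Nat.odd_mul] at hu
      exact ⟨Nat.odd_iff.1 hu.1, Nat.odd_iff.1 hu.2⟩
    obtain ⟨a0, a1⟩ := iha h1
    obtain ⟨b0, b1⟩ := ihb h2
    rw [fsum_mul hab]
    refine ⟨mul_nonneg a0 b0, ?_⟩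
    calc fsum a * fsum b ≤ (Pr a).card * (Pr b).card := mul_le_mul a1 b1 b0 (by positivity)
      _ ≤ _ := by exact_mod_cast card_Pr_mul hab

noncomputable def rep (n k : ℕ) : Finset (Fin n → ℤ) :=
  (Fintype.piFinset fun _ => Icc (-(k:ℤ)) k).filter (fun z => ∑ i, (z i) ^ 2 = (k : ℤ))

lemma mem_rep {n k : ℕ} {z : Fin n → ℤ} : z ∈ rep n k ↔ ∑ i, (z i) ^ 2 = (k : ℤ) := by
  simp only [rep, mem_filter, Fintype.mem_piFinset, mem_Icc, and_iff_right_iff_imp]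
  intro h i
  have : (z i) ^ 2 ≤ k := by
    rw [← h]
    exact Finset.single_le_sum (f := fun i => (z i) ^ 2) (fun i _ => sq_nonneg _) (mem_univ i)
  constructor <;> nlinarith

def nn (p : ℤ × ℤ) : ℕ := p.1.natAbs ^ 2 + p.2.natAbs ^ 2

lemma nn_cast (p : ℤ × ℤ) : (nn p : ℤ) = p.1 ^ 2 + p.2 ^ 2 := by
  simp [nn]

lemma conv2 (n k : ℕ) (T : Finset (ℤ × ℤ)) (hT : ∀ p ∈ T, nn p ≤ k) :
    ∑ p ∈ T, (rep n (k - nn p)).card ≤ (rep (n + 2) k).card := by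
  rw [← card_sigma]
  refine card_le_card_of_injOn
    (fun x => (Fin.cons x.1.1 (Fin.cons x.1.2 x.2 : Fin (n+1) → ℤ) : Fin (n+2) → ℤ)) ?_ ?_
  · rintro ⟨p, z⟩ h
    rw [mem_coe, mem_sigma, mem_rep] at h
    rw [mem_coe, mem_rep, Fin.sum_univ_succ, Fin.sum_univ_succ]
    have h1 := hT p h.1
    have h2 := h.2
    simp only [Fin.cons_zero, Fin.cons_succ] at h2 ⊢
    rw [h2, Nat.cast_sub h1, nn_cast]; ring
  · rintro ⟨p, z⟩ _ ⟨p', z'⟩ _ h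
    simp only [Fin.cons_inj] at h
    obtain ⟨h1, h2, rfl⟩ := h
    obtain rfl : p = p' := Prod.ext h1 h2
    rfl

lemma rep_succ (n k : ℕ) : (rep n k).card ≤ (rep (n + 1) k).card := by
  refine card_le_card_of_injOn (fun z => (Fin.cons 0 z : Fin (n+1) → ℤ)) ?_ ?_
  · intro z h
    rw [mem_coe, mem_rep] at h
    rw [mem_coe, mem_rep, Fin.sum_univ_succ]
    simpa using h
  · intro z _ z' _ h
    simp only [Fin.cons_inj] at h
    exact h.2

lemma sum_fsum (n : ℕ) :
    ∑ p ∈ (antidiagonal (2 * n)).filter (fun p => p.1 % 2 = 1), fsum p.1 * fsum p.2 =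
      ∑ q ∈ Qd n, sgn4 q.1 * sgn4 q.2.2.1 := by
  have hf : ∀ u, fsum u = ∑ x ∈ u.divisorsAntidiagonal, sgn4 x.1 := by
    intro u
    rw [Nat.sum_divisorsAntidiagonal (fun i _ => sgn4 i)]; rfl
  simp only [hf, sum_mul_sum, ← sum_product', sum_sigma']
  refine Finset.sum_bij' (fun x _ => (x.2.1.1, x.2.1.2, x.2.2.1, x.2.2.2))
    (fun q _ => ⟨(q.1 * q.2.1, q.2.2.1 * q.2.2.2), ((q.1, q.2.1), (q.2.2.1, q.2.2.2))⟩)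
    ?_ ?_ ?_ ?_ ?_
  · rintro ⟨⟨u, v⟩, ⟨d, a⟩, ⟨e, b⟩⟩ h
    simp only [mem_sigma, mem_filter, HasAntidiagonal.mem_antidiagonal, mem_product,
      Nat.mem_divisorsAntidiagonal] at h
    rw [mem_Qd]
    obtain ⟨⟨h1, h2⟩, ⟨h3, h4⟩, h5, h6⟩ := h
    have hv : v % 2 = 1 := by omega
    rw [← h3, ← Nat.odd_iff, Nat.odd_mul, Nat.odd_iff, Nat.odd_iff] at h2
    rw [← h5, ← Nat.odd_iff, Nat.odd_mul, Nat.odd_iff, Nat.odd_iff] at hv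
    exact ⟨h2.1, h2.2, hv.1, hv.2, by rw [h3, h5]; exact h1⟩
  · rintro ⟨d, a, e, b⟩ h
    rw [mem_Qd] at h
    obtain ⟨h1, h2, h3, h4, h5⟩ := h
    have hd : 1 ≤ d := by omega
    have ha : 1 ≤ a := by omega
    have he : 1 ≤ e := by omega
    have hb : 1 ≤ b := by omega
    have h6 : (d * a) % 2 = 1 := by
      rw [← Nat.odd_iff, Nat.odd_mul, Nat.odd_iff, Nat.odd_iff]; exact ⟨h1, h2⟩
    simp only [mem_sigma, mem_filter, HasAntidiagonal.mem_antidiagonal, mem_product,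
      Nat.mem_divisorsAntidiagonal]
    exact ⟨⟨h5, h6⟩, ⟨trivial, by positivity⟩, trivial, by positivity⟩
  · rintro ⟨⟨u, v⟩, ⟨d, a⟩, ⟨e, b⟩⟩ h
    simp only [mem_sigma, mem_filter, HasAntidiagonal.mem_antidiagonal, mem_product,
      Nat.mem_divisorsAntidiagonal] at h
    obtain ⟨⟨h1, h2⟩, ⟨h3, h4⟩, h5, h6⟩ := h
    subst h3
    subst h5
    rfl
  · rintro ⟨d, a, e, b⟩ h; rfl
  · rintro ⟨⟨u, v⟩, ⟨d, a⟩, ⟨e, b⟩⟩ h; rfl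

lemma sign_primary {s s' : ℤ} {z z' : GaussianInt} (hs : s = 1 ∨ s = -1) (hs' : s' = 1 ∨ s' = -1)
    (hz : Primary z) (hz' : Primary z') (h1 : s * z.re = s' * z'.re) (h2 : s * z.im = s' * z'.im) :
    s = s' ∧ z = z' := by
  obtain ⟨a, b⟩ := z
  obtain ⟨a', b'⟩ := z'
  unfold Primary at hz hz'
  simp only at *
  have : s = s' ∧ a = a' ∧ b = b' := by
    rcases hs with rfl | rfl <;> rcases hs' with rfl | rfl <;> omega
  obtain ⟨rfl, rfl, rfl⟩ := this
  exact ⟨rfl, rfl⟩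

lemma four_bound (n : ℕ) (hn : n % 2 = 1) : 4 * n ≤ (rep 4 n).card := by
  set P := (antidiagonal (2 * n)).filter (fun p => p.1 % 2 = 1) with hP
  have h1 : (n : ℤ) ≤ ∑ p ∈ P, ((Pr p.1).card * (Pr p.2).card : ℕ) := by
    refine (key_sum hn).trans ?_
    rw [← sum_fsum]
    push_cast
    refine sum_le_sum ?_
    rintro ⟨u, v⟩ h
    simp only [hP, mem_filter, HasAntidiagonal.mem_antidiagonal] at h
    obtain ⟨u0, u1⟩ := fsum_le u h.2
    obtain ⟨v0, v1⟩ := fsum_le v (by omega)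
    exact mul_le_mul u1 v1 v0 (by positivity)
  have h1' : n ≤ ∑ p ∈ P, (Pr p.1).card * (Pr p.2).card := by exact_mod_cast h1
  let D := (({1, -1} : Finset ℤ) ×ˢ ({1, -1} : Finset ℤ)) ×ˢ
    (P.sigma fun p => Pr p.1 ×ˢ Pr p.2)
  have hD : D.card = 4 * ∑ p ∈ P, (Pr p.1).card * (Pr p.2).card := by
    simp only [D, card_product, card_sigma]
    congr 1
  refine (Nat.mul_le_mul_left 4 h1').trans ?_
  rw [← hD]
  refine card_le_card_of_injOn (fun x =>
    ![(x.1.1 * x.2.2.1.re + x.1.2 * x.2.2.2.re) / 2, (x.1.1 * x.2.2.1.re - x.1.2 * x.2.2.2.re) / 2,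
      (x.1.1 * x.2.2.1.im + x.1.2 * x.2.2.2.im) / 2,
      (x.1.1 * x.2.2.1.im - x.1.2 * x.2.2.2.im) / 2]) ?_ ?_
  · rintro ⟨⟨s, t⟩, ⟨⟨u, v⟩, ⟨z, w⟩⟩⟩ h
    simp only [D, mem_coe, mem_product, mem_insert, mem_singleton, mem_sigma, mem_Pr, hP,
      mem_filter, HasAntidiagonal.mem_antidiagonal] at h
    obtain ⟨⟨hs, ht⟩, ⟨huv, hu⟩, ⟨hz, hz1, hz2⟩, ⟨hw, hw1, hw2⟩⟩ := h
    rw [Zsqrtd.norm_def] at hz hw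
    rw [mem_coe, mem_rep, Fin.sum_univ_four]
    simp only [Matrix.cons_val]
    have huv' : (u : ℤ) + v = 2 * n := by exact_mod_cast huv
    obtain ⟨A, hA⟩ : ∃ A, s * z.re + t * w.re = 2 * A := ⟨(s * z.re + t * w.re) / 2, by
      rcases hs with rfl | rfl <;> rcases ht with rfl | rfl <;> omega⟩
    obtain ⟨B, hB⟩ : ∃ A, s * z.re - t * w.re = 2 * A := ⟨(s * z.re - t * w.re) / 2, by
      rcases hs with rfl | rfl <;> rcases ht with rfl | rfl <;> omega⟩
    obtain ⟨C, hC⟩ : ∃ A, s * z.im + t * w.im = 2 * A := ⟨(s * z.im + t * w.im) / 2, by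
      rcases hs with rfl | rfl <;> rcases ht with rfl | rfl <;> omega⟩
    obtain ⟨E, hE⟩ : ∃ A, s * z.im - t * w.im = 2 * A := ⟨(s * z.im - t * w.im) / 2, by
      rcases hs with rfl | rfl <;> rcases ht with rfl | rfl <;> omega⟩
    rw [hA, hB, hC, hE]
    simp only [Int.mul_ediv_cancel_left _ (two_ne_zero)]
    have hs2 : s ^ 2 = 1 := by rcases hs with rfl | rfl <;> norm_num
    have ht2 : t ^ 2 = 1 := by rcases ht with rfl | rfl <;> norm_num
    have e : 4 * (A ^ 2 + B ^ 2 + C ^ 2 + E ^ 2) = 4 * (n : ℤ) := by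
      calc 4 * (A ^ 2 + B ^ 2 + C ^ 2 + E ^ 2)
          = (2 * A) ^ 2 + (2 * B) ^ 2 + (2 * C) ^ 2 + (2 * E) ^ 2 := by ring
        _ = s ^ 2 * (2 * (z.re * z.re - -1 * z.im * z.im)) +
            t ^ 2 * (2 * (w.re * w.re - -1 * w.im * w.im)) := by
            rw [← hA, ← hB, ← hC, ← hE]; ring
        _ = 4 * n := by rw [hs2, ht2, hz, hw]; linarith
    linarith
  · rintro ⟨⟨s, t⟩, ⟨⟨u, v⟩, ⟨z, w⟩⟩⟩ h ⟨⟨s', t'⟩, ⟨⟨u', v'⟩, ⟨z', w'⟩⟩⟩ h' heq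
    simp only [D, mem_coe, mem_product, mem_insert, mem_singleton, mem_sigma, mem_Pr, hP,
      mem_filter, HasAntidiagonal.mem_antidiagonal] at h h'
    obtain ⟨⟨hs, ht⟩, ⟨huv, hu⟩, ⟨hz, hzp⟩, ⟨hw, hwp⟩⟩ := h
    obtain ⟨⟨hs', ht'⟩, ⟨huv', hu'⟩, ⟨hz', hzp'⟩, ⟨hw', hwp'⟩⟩ := h'
    have q0 := congrFun heq 0
    have q1 := congrFun heq 1
    have q2 := congrFun heq 2
    have q3 := congrFun heq 3
    simp only [Matrix.cons_val] at q0 q1 q2 q3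
    have par : ∀ (s : ℤ) (z : GaussianInt), (s = 1 ∨ s = -1) → Primary z →
        (s * z.re) % 2 = 1 ∧ (s * z.im) % 2 = 0 := by
      rintro s z hs ⟨a, b⟩
      rcases hs with rfl | rfl <;> omega
    have p1 := par s z hs hzp
    have p2 := par t w ht hwp
    have p3 := par s' z' hs' hzp'
    have p4 := par t' w' ht' hwp'
    obtain ⟨rfl, rfl⟩ := sign_primary hs hs' hzp hzp' (by omega) (by omega)
    obtain ⟨rfl, rfl⟩ := sign_primary ht ht' hwp hwp' (by omega) (by omega)
    have e1 : u = u' := by rw [hz] at hz'; exact_mod_cast hz'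
    have e2 : v = v' := by rw [hw] at hw'; exact_mod_cast hw'
    subst e1
    subst e2
    rfl

lemma six_aux (k : ℕ) (T : Finset (ℤ × ℤ)) (hT : ∀ p ∈ T, nn p ≤ k ∧ (nn p + k) % 2 = 1) :
    ∑ p ∈ T, 4 * (k - nn p) ≤ (rep 6 k).card := by
  refine le_trans (sum_le_sum ?_) (conv2 4 k T fun p hp => (hT p hp).1)
  intro p hp
  have := hT p hp
  exact four_bound _ (by omega)

lemma six_big (k : ℕ) (hk : 16 ≤ k) : (k + 1) * (k + 2) ≤ 2 * (rep 6 k).card := by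
  obtain ⟨s, hs⟩ : ∃ s, s = Nat.sqrt k / 2 := ⟨_, rfl⟩
  have hr1 : Nat.sqrt k * Nat.sqrt k ≤ k := Nat.sqrt_le k
  have hr2 : k < (Nat.sqrt k + 1) * (Nat.sqrt k + 1) := Nat.lt_succ_sqrt k
  have hs2 : 2 ≤ s := by
    have : 4 ≤ Nat.sqrt k := Nat.le_sqrt.2 (by omega)
    omega
  have hsa : 4 * (s * s) ≤ k := by
    have : 2 * s ≤ Nat.sqrt k := by omega
    nlinarith
  have hsb : k < 4 * ((s + 1) * (s + 1)) := by
    have : Nat.sqrt k + 1 ≤ 2 * (s + 1) := by omega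
    nlinarith
  let T : Finset (ℤ × ℤ) := ((Icc (-(s:ℤ)) s) ×ˢ range s).image
    (fun x => (x.1, -(s:ℤ) + 2 * x.2 + (x.1 + s + k + 1) % 2))
  have hcard : T.card = (2 * s + 1) * s := by
    rw [card_image_of_injOn, card_product]
    · simp only [Int.card_Icc, card_range]
      congr 1
      omega
    · rintro ⟨a, j⟩ _ ⟨a', j'⟩ _ h
      simp only [Prod.mk.injEq] at h
      obtain ⟨rfl, h⟩ := h
      simp only [Prod.mk.injEq, true_and]
      omega
  have hmem : ∀ p ∈ T, 2 * nn p ≤ k ∧ (nn p + k) % 2 = 1 := by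
    intro p hp
    simp only [T, mem_image, mem_product, mem_Icc, mem_range] at hp
    obtain ⟨⟨a, j⟩, ⟨⟨ha1, ha2⟩, hj⟩, rfl⟩ := hp
    simp only at ha1 ha2 hj ⊢
    obtain ⟨b, hb⟩ : ∃ b, b = -(s:ℤ) + 2 * j + (a + s + k + 1) % 2 := ⟨_, rfl⟩
    rw [← hb]
    have hb1 : -(s:ℤ) ≤ b := by omega
    have hb2 : b ≤ s := by omega
    have hpar : (a + b + k) % 2 = 1 := by omega
    have hN := nn_cast (a, b)
    simp only at hN
    constructor
    · have h1 : a ^ 2 ≤ s ^ 2 := sq_le_sq' ha1 ha2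
      have h2 : b ^ 2 ≤ s ^ 2 := sq_le_sq' hb1 hb2
      have : (4 * (s * s) : ℤ) ≤ k := by exact_mod_cast hsa
      zify
      nlinarith
    · have h1 : a ^ 2 % 2 = a % 2 := by
        rcases Int.emod_two_eq_zero_or_one a with h | h <;> rw [pow_two, Int.mul_emod, h] <;> rfl
      have h2 : b ^ 2 % 2 = b % 2 := by
        rcases Int.emod_two_eq_zero_or_one b with h | h <;> rw [pow_two, Int.mul_emod, h] <;> rfl
      omega
  have h1 := six_aux k T (fun p hp => by have := hmem p hp; omega)
  have h2 : T.card * (2 * k) ≤ ∑ p ∈ T, 4 * (k - nn p) := by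
    rw [← smul_eq_mul, ← Finset.sum_const]
    refine sum_le_sum ?_
    intro p hp
    have := hmem p hp
    omega
  rw [hcard] at h2
  have h3 : k + 4 ≤ 4 * ((2 * s + 1) * s) := by nlinarith
  have h4 := Nat.mul_le_mul_right k h3
  nlinarith

lemma six_small (k : ℕ) (hk : k < 16) : (k + 1) * (k + 2) ≤ 2 * (rep 6 k).card := by
  rcases Nat.eq_zero_or_pos k with rfl | hk0
  · have : (0 : Fin 6 → ℤ) ∈ rep 6 0 := by rw [mem_rep]; simp
    have := card_pos.2 ⟨_, this⟩
    omega
  rcases Nat.mod_two_eq_zero_or_one k with he | ho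
  · have h := six_aux k {(1, 0), (-1, 0), (0, 1), (0, -1)} (by
      intro p hp
      simp only [mem_insert, mem_singleton] at hp
      rcases hp with rfl | rfl | rfl | rfl <;> simp [nn] <;> omega)
    rw [sum_insert (by decide), sum_insert (by decide), sum_insert (by decide),
      sum_singleton] at h
    simp [nn] at h
    interval_cases k <;> omega
  · by_cases h3 : k ≤ 3
    · have h := six_aux k {(0, 0)} (by
        intro p hp
        simp only [mem_singleton] at hp
        rcases hp with rfl; simp [nn]; omega)
      rw [sum_singleton] at h
      simp [nn] at h
      interval_cases k <;> omega
    · have h := six_aux k {(0, 0), (1, 1), (-1, 1), (1, -1), (-1, -1)} (by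
        intro p hp
        simp only [mem_insert, mem_singleton] at hp
        rcases hp with rfl | rfl | rfl | rfl | rfl <;> simp [nn] <;> omega)
      rw [sum_insert (by decide), sum_insert (by decide), sum_insert (by decide),
        sum_insert (by decide), sum_singleton] at h
      simp [nn] at h
      interval_cases k <;> omega

lemma six_bound (k : ℕ) : (2 + k).choose 2 ≤ (rep 6 k).card := by
  have h : (k + 1) * (k + 2) ≤ 2 * (rep 6 k).card := by
    rcases lt_or_ge k 16 with h | h
    · exact six_small k h
    · exact six_big k h
  rw [Nat.choose_two_right]
  apply Nat.div_le_of_le_mul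
  have : 2 + k - 1 = k + 1 := by omega
  rw [this]
  linarith

noncomputable def Tj (j : ℕ) : Finset (ℤ × ℤ) := ((Icc (-(j:ℤ)) j) ×ˢ (Icc (-(j:ℤ)) j)).filter (fun p => nn p ≤ j)

lemma mem_Tj {j : ℕ} {p : ℤ × ℤ} : p ∈ Tj j ↔ nn p ≤ j := by
  simp only [Tj, mem_filter, mem_product, mem_Icc, and_iff_right_iff_imp]
  intro h
  have h' : (nn p : ℤ) ≤ j := by exact_mod_cast h
  rw [nn_cast] at h'
  refine ⟨⟨?_, ?_⟩, ?_, ?_⟩ <;> nlinarith [sq_nonneg p.1, sq_nonneg p.2]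

lemma card_Tj (j : ℕ) : j + 1 ≤ (Tj j).card := by
  obtain ⟨s, hs⟩ : ∃ s, s = Nat.sqrt (j / 2) := ⟨_, rfl⟩
  have hr1 : s * s ≤ j / 2 := hs ▸ Nat.sqrt_le _
  have hr2 : j / 2 < (s + 1) * (s + 1) := hs ▸ Nat.lt_succ_sqrt _
  rcases Nat.eq_zero_or_pos s with h0 | h0
  · subst h0
    have : j = 0 ∨ j = 1 := by omega
    rcases this with rfl | rfl
    · exact card_pos.2 ⟨(0, 0), mem_Tj.2 (by simp [nn])⟩
    · have : ({(0, 0), (1, 0)} : Finset (ℤ × ℤ)) ⊆ Tj 1 := by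
        intro p hp
        simp only [mem_insert, mem_singleton] at hp
        rw [mem_Tj]
        rcases hp with rfl | rfl <;> simp [nn]
      exact (card_le_card this)
  · have hsub : (Icc (-(s:ℤ)) s) ×ˢ (Icc (-(s:ℤ)) s) ⊆ Tj j := by
      rintro ⟨a, b⟩ hp
      simp only [mem_product, mem_Icc] at hp
      rw [mem_Tj]
      have h1 : a ^ 2 ≤ s ^ 2 := sq_le_sq' hp.1.1 hp.1.2
      have h2 : b ^ 2 ≤ s ^ 2 := sq_le_sq' hp.2.1 hp.2.2
      have h3 : 2 * (s * s) ≤ j := by omega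
      zify at h3 ⊢
      rw [nn_cast]
      simp only
      nlinarith
    have := card_le_card hsub
    rw [card_product] at this
    simp only [Int.card_Icc] at this
    rw [show ((s:ℤ) + 1 - -(s:ℤ)).toNat = 2 * s + 1 by omega] at this
    nlinarith [show j + 1 ≤ 2 * ((s + 1) * (s + 1)) by omega]

lemma abel (F : ℕ → ℕ) (hF : Antitone F) (j : ℕ) :
    ∑ i ∈ range (j + 1), F i + (Tj j).card * F j ≤ ∑ p ∈ Tj j, F (nn p) + (j + 1) * F j := by
  induction j with
  | zero =>
    have : ∀ p ∈ Tj 0, F (nn p) = F 0 := by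
      intro p hp
      rw [mem_Tj] at hp
      rw [Nat.le_zero.1 hp]
    rw [sum_congr rfl this]
    simp; omega
  | succ j ih =>
    have hsub : Tj j ⊆ Tj (j+1) := by
      intro p hp; rw [mem_Tj] at *; omega
    have e1 : ∑ p ∈ Tj (j+1), F (nn p) =
        ∑ p ∈ Tj (j+1) \ Tj j, F (nn p) + ∑ p ∈ Tj j, F (nn p) := (sum_sdiff hsub).symm
    have e2 : ∀ p ∈ Tj (j+1) \ Tj j, F (nn p) = F (j+1) := by
      intro p hp
      rw [mem_sdiff, mem_Tj, mem_Tj] at hp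
      rw [show nn p = j + 1 by omega]
    have e3 : (Tj (j+1)).card = (Tj (j+1) \ Tj j).card + (Tj j).card :=
      (card_sdiff_add_card_eq_card hsub).symm
    rw [e1, sum_congr rfl e2, sum_const, smul_eq_mul, sum_range_succ, e3]
    obtain ⟨c, hc⟩ : ∃ c, (Tj j).card = j + 1 + c := ⟨_, (Nat.add_sub_of_le (card_Tj j)).symm⟩
    have h1 : F (j+1) ≤ F j := hF (by omega)
    have h2 : c * F (j+1) ≤ c * F j := Nat.mul_le_mul_left c h1
    rw [hc] at ih ⊢
    nlinarith

lemma hockey (t k : ℕ) : ∑ i ∈ range (k + 1), (t + (k - i)).choose t = (t + 1 + k).choose (t + 1) := by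
  induction k with
  | zero => simp
  | succ k ih =>
    rw [sum_range_succ']
    have : ∀ i ∈ range (k + 1), (t + (k + 1 - (i + 1))).choose t = (t + (k - i)).choose t := by
      intro i _; congr 2; omega
    rw [sum_congr rfl this, ih]
    rw [show t + 1 + (k + 1) = (t + 1 + k) + 1 by ring, Nat.choose_succ_succ (t + 1 + k) t,
      add_comm]
    congr 2
    omega

lemma even_bound (t : ℕ) (ht : 2 ≤ t) : ∀ k, (t + k).choose t ≤ (rep (2 * t + 2) k).card := by
  induction t, ht using Nat.le_induction with
  | base => intro k; exact six_bound k
  | succ t ht ih =>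
    intro k
    rw [← hockey]
    have hF : Antitone (fun i => (t + (k - i)).choose t) := by
      intro i j hij
      exact Nat.choose_le_choose t (by omega)
    have h := abel _ hF k
    have h2 := Nat.mul_le_mul_right ((t + (k - k)).choose t) (card_Tj k)
    have h3 : ∑ p ∈ Tj k, (t + (k - nn p)).choose t ≤ (rep (2 * (t + 1) + 2) k).card := by
      refine le_trans (sum_le_sum fun p _ => ih (k - nn p)) ?_
      exact conv2 (2 * t + 2) k (Tj k) (fun p hp => mem_Tj.1 hp)
    omega

end LatticeHelpers

/-- For every `n ≥ 6` and every positive integer `k`, the number of integer vectors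
`z ∈ ℤ^n` with `‖z‖² = k` is at least `(⌊n/2⌋ + k - 1).choose k`. -/
theorem integer_lattice_sphere_lower (n k : ℕ) (hn : 6 ≤ n) (hk : 0 < k) :
    {z : Fin n → ℤ | ∑ i, (z i) ^ 2 = (k : ℤ)}.Finite ∧
      Nat.choose (n / 2 + k - 1) k ≤ {z : Fin n → ℤ | ∑ i, (z i) ^ 2 = (k : ℤ)}.ncard := by
  have hset : {z : Fin n → ℤ | ∑ i, (z i) ^ 2 = (k : ℤ)} = ↑(rep n k) := by
    ext z
    rw [Finset.mem_coe, mem_rep]; rfl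
  rw [hset]
  refine ⟨Finset.finite_toSet _, ?_⟩
  rw [Set.ncard_coe_finset]
  obtain ⟨t, ht⟩ : ∃ t, n / 2 = t + 1 := ⟨n / 2 - 1, by omega⟩
  have h1 := even_bound t (by omega) k
  rw [ht, show t + 1 + k - 1 = t + k by omega, ← Nat.choose_symm_add]
  have hc : n = 2 * t + 2 ∨ n = 2 * t + 2 + 1 := by omega
  rcases hc with rfl | rfl
  · exact h1
  · exact h1.trans (rep_succ _ _)
end

section
/- For every positive integer k, the number of integer vectors z ∈ ℤ^8 with z₁² + ⋯ + z₈² = k is at least binomial(k + 3, 3). In fact, this count is at least 14k³. -/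
def H0 (x d e : ℤ) : ℤ :=
  (-600)*d*e^4 + (320)*d^4*e + (1200)*x*e^4 + (-2400)*x*d*e^3 + (-1200)*x*d^2*e^2 +
    (-1440)*x*d^3*e + (600)*x*d^4 + (4800)*x^2*e^3 + (-2560)*x^2*d^3 + (4800)*x^3*e^2 +
    (3200)*x^3*d*e + (2880)*x^3*d^2 + (-640)*x^5

def H1 (x d e : ℤ) : ℤ :=
  (320)*d*e^4 + (-600)*d^4*e + (-600)*x*e^4 + (1440)*x*d*e^3 + (1200)*x*d^2*e^2 +
    (2400)*x*d^3*e + (-1200)*x*d^4 + (-2560)*x^2*e^3 + (4800)*x^2*d^3 + (-2880)*x^3*e^2 +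
    (-3200)*x^3*d*e + (-4800)*x^3*d^2 + (640)*x^5

def H2 (x d e : ℤ) : ℤ :=
  (280)*d*e^4 + (280)*d^4*e + (-600)*x*e^4 + (960)*x*d*e^3 + (-960)*x*d^3*e + (600)*x*d^4
    + (-2240)*x^2*e^3 + (-2240)*x^2*d^3 + (-1920)*x^3*e^2 + (1920)*x^3*d^2

def H3 (x d e : ℤ) : ℤ :=
  (280)*d*e^4 + (280)*d^4*e + (-532)*x*e^4 + (392)*x*d*e^3 + (-392)*x*d^3*e + (532)*x*d^4
    + (-2240)*x^2*e^3 + (-2240)*x^2*d^3 + (-2352)*x^3*e^2 + (2352)*x^3*d^2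

def H4 (x d e : ℤ) : ℤ :=
  (476)*d*e^4 + (-840)*d^2*e^3 + (-840)*d^3*e^2 + (476)*d^4*e + (-952)*x*e^4 +
    (3584)*x*d*e^3 + (-3584)*x*d^3*e + (952)*x*d^4 + (-3808)*x^2*e^3 + (5376)*x^2*d*e^2 +
    (5376)*x^2*d^2*e + (-3808)*x^2*d^3 + (-4032)*x^3*e^2 + (4032)*x^3*d^2 + (-448)*x^4*e +
    (-448)*x^4*d

def H5 (x d e : ℤ) : ℤ :=
  (-56)*d*e^4 + (-1680)*d^2*e^3 + (840)*d^3*e^2 + (252)*d^4*e + (112)*x*e^4 +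
    (3136)*x*d*e^3 + (-7056)*x*d^2*e^2 + (-56)*x*d^3*e + (532)*x*d^4 + (448)*x^2*e^3 +
    (10752)*x^2*d*e^2 + (-5376)*x^2*d^2*e + (-2016)*x^2*d^3 + (9408)*x^3*d*e +
    (1680)*x^3*d^2 + (-896)*x^4*e + (448)*x^4*d

def H6 (x d e : ℤ) : ℤ :=
  (252)*d*e^4 + (840)*d^2*e^3 + (-1680)*d^3*e^2 + (-56)*d^4*e + (-532)*x*e^4 +
    (56)*x*d*e^3 + (7056)*x*d^2*e^2 + (-3136)*x*d^3*e + (-112)*x*d^4 + (-2016)*x^2*e^3 +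
    (-5376)*x^2*d*e^2 + (10752)*x^2*d^2*e + (448)*x^2*d^3 + (-1680)*x^3*e^2 +
    (-9408)*x^3*d*e + (448)*x^4*e + (-896)*x^4*d

/-- The weight function, depending on the parities of its arguments. -/
def HH (x d e : ℤ) : ℤ :=
  (1 - (x % 2))*(1 - (d % 2))*(e % 2) * H0 x d e
  + (1 - (x % 2))*(d % 2)*(1 - (e % 2)) * H1 x d e
  + (x % 2)*(d % 2)*(e % 2) * H2 x d e
  + (1 - (x % 2))*(d % 2)*(e % 2) * H3 x d e
  + (x % 2)*(1 - (d % 2))*(1 - (e % 2)) * H4 x d e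
  + (x % 2)*(1 - (d % 2))*(e % 2) * H5 x d e
  + (x % 2)*(d % 2)*(1 - (e % 2)) * H6 x d e

def GG (x d e : ℤ) : ℤ :=
  (1 - x % 2) * ((-640)*d*e^4 + (-640)*x^2*d^3)
    + (x % 2) * ((448)*d*e^4 + (-3360)*d^2*e^3 + (21504)*x^2*d*e^2 + (448)*x^2*d^3 +
    (-1792)*x^4*e)

def GG2 (x d e : ℤ) : ℤ :=
  (1 - x % 2) * ((-80)*d*e^4 + (-5120)*x^2*d^3)
    + (x % 2) * ((56)*d*e^4 + (-1680)*d^2*e^3 + (10752)*x^2*d*e^2 + (3584)*x^2*d^3 +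
    (-896)*x^4*e)

def QQ (m x : ℤ) : ℤ :=
    (1 - m % 2) * ((1 - x % 2) * ((280)*x*m + (400)*x*m^3 + (280)*x*m^5 + (-400)*x^3*m +
    (-400)*x^3*m^3 + (120)*x^5*m)
      + (x % 2) * ((-280)*m^5 + (-320)*x*m + (-800)*x*m^3 + (280)*x*m^5 + (1200)*x^2*m^3 +
    (800)*x^3*m + (-400)*x^3*m^3 + (-600)*x^4*m + (120)*x^5*m))
    + (m % 2) * ((1 - x % 2) * ((-252)*x*m + (-504)*x*m^3 + (-84)*x*m^5 + (336)*x^2*m^3 +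
    (392)*x^3*m + (168)*x^3*m^3 + (-56)*x^4*m + (-84)*x^5*m)
      + (x % 2) * ((644)*m^5 + (280)*x*m + (672)*x*m^3 + (-84)*x*m^5 + (-840)*x^2*m^3 +
    (-672)*x^3*m + (168)*x^3*m^3 + (476)*x^4*m + (-84)*x^5*m))


def sg (d e : ℤ) : ℤ := 1 - 2 * (d % 2) * (1 - e % 2)

def WW (x d e : ℤ) : ℤ := (d * e - 8 * x ^ 2) * (sg d e * d ^ 3)

def TT (x d e : ℤ) : ℤ := (1 - d % 2) * GG x d e - (1 - e % 2) * GG2 x d e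

lemma HH_sigma (x d e : ℤ) : HH (-x) e d = HH x d e := by
  have h1 : (-x) % 2 = x % 2 := by omega
  simp only [HH, H0, H1, H2, H3, H4, H5, H6, h1]
  rcases Int.emod_two_eq_zero_or_one x with h | h <;>
  rcases Int.emod_two_eq_zero_or_one d with h' | h' <;>
  rcases Int.emod_two_eq_zero_or_one e with h'' | h'' <;>
  · rw [h, h', h'']; ring

lemma HH_phi (x d e : ℤ) : HH (-x - e) (d - 2 * x - e) e = - HH x d e := by
  simp only [HH, H0, H1, H2, H3, H4, H5, H6]
  rcases Int.emod_two_eq_zero_or_one x with h | h <;>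
  rcases Int.emod_two_eq_zero_or_one d with h' | h' <;>
  rcases Int.emod_two_eq_zero_or_one e with h'' | h'' <;>
  · first
    | rw [h, h', h'', show (-x - e) % 2 = 0 by omega, show (d - 2 * x - e) % 2 = 0 by omega]; ring
    | rw [h, h', h'', show (-x - e) % 2 = 0 by omega, show (d - 2 * x - e) % 2 = 1 by omega]; ring
    | rw [h, h', h'', show (-x - e) % 2 = 1 by omega, show (d - 2 * x - e) % 2 = 0 by omega]; ring
    | rw [h, h', h'', show (-x - e) % 2 = 1 by omega, show (d - 2 * x - e) % 2 = 1 by omega]; ring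

/-- The symmetrization identity. -/
lemma HH_sym (x d e : ℤ) :
    HH x d e + HH (-x) d e =
      (560 * WW x d e + TT x d e) + (560 * WW x e d + TT x e d) := by
  have h1 : (-x) % 2 = x % 2 := by omega
  simp only [HH, H0, H1, H2, H3, H4, H5, H6, WW, TT, GG, GG2, sg, h1]
  rcases Int.emod_two_eq_zero_or_one x with h | h <;>
  rcases Int.emod_two_eq_zero_or_one d with h' | h' <;>
  rcases Int.emod_two_eq_zero_or_one e with h'' | h'' <;>
  · rw [h, h', h'']; ring

lemma HH_bdry (m x : ℤ) : HH x (m + x) (m - x) = QQ m (x + 1) - QQ m x := by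
  simp only [HH, H0, H1, H2, H3, H4, H5, H6, QQ]
  rcases Int.emod_two_eq_zero_or_one x with h | h <;>
  rcases Int.emod_two_eq_zero_or_one m with h' | h' <;>
  · first
    | rw [h, h', show (m + x) % 2 = 0 by omega, show (m - x) % 2 = 0 by omega,
        show (x + 1) % 2 = 1 by omega]; ring
    | rw [h, h', show (m + x) % 2 = 1 by omega, show (m - x) % 2 = 1 by omega,
        show (x + 1) % 2 = 1 by omega]; ring
    | rw [h, h', show (m + x) % 2 = 0 by omega, show (m - x) % 2 = 0 by omega,
        show (x + 1) % 2 = 0 by omega]; ring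
    | rw [h, h', show (m + x) % 2 = 1 by omega, show (m - x) % 2 = 1 by omega,
        show (x + 1) % 2 = 0 by omega]; ring

lemma QQ_end (m : ℤ) : QQ m m - QQ m (-m + 1) = 560 * m ^ 2 := by
  simp only [QQ]
  rcases Int.emod_two_eq_zero_or_one m with h' | h'
  · rw [h', show (-m + 1) % 2 = 1 by omega]; ring
  · rw [h', show (-m + 1) % 2 = 0 by omega]; ring

open Finset in
noncomputable def SS (n : ℤ) : Finset (ℤ × ℤ × ℤ) :=
  ((Icc (-n) n) ×ˢ (Icc 1 n ×ˢ Icc 1 n)).filter (fun p => p.1 ^ 2 + p.2.1 * p.2.2 = n)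

lemma mem_SS (n x d e : ℤ) : (x, d, e) ∈ SS n ↔ 0 < d ∧ 0 < e ∧ x ^ 2 + d * e = n := by
  simp only [SS, Finset.mem_filter, Finset.mem_product, Finset.mem_Icc]
  constructor
  · rintro ⟨⟨_, h1, h2⟩, h⟩
    exact ⟨by omega, by omega, h⟩
  · rintro ⟨h1, h2, h⟩
    have := Int.le_self_sq x
    have := Int.le_self_sq (-x)
    refine ⟨⟨⟨?_, ?_⟩, ⟨?_, ?_⟩, ?_, ?_⟩, h⟩ <;> nlinarith [sq_nonneg x, mul_pos h1 h2]

lemma sum_SS_iota (n : ℤ) (f : ℤ → ℤ → ℤ → ℤ) :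
    ∑ p ∈ SS n, f (-p.1) p.2.1 p.2.2 = ∑ p ∈ SS n, f p.1 p.2.1 p.2.2 := by
  refine Finset.sum_nbij' (fun p => (-p.1, p.2.1, p.2.2)) (fun p => (-p.1, p.2.1, p.2.2)) ?_ ?_ ?_ ?_ ?_
  all_goals rintro ⟨x, d, e⟩ h
  all_goals simp_all [mem_SS]

lemma sum_SS_swap (n : ℤ) (f : ℤ → ℤ → ℤ → ℤ) :
    ∑ p ∈ SS n, f p.1 p.2.2 p.2.1 = ∑ p ∈ SS n, f p.1 p.2.1 p.2.2 := by
  refine Finset.sum_nbij' (fun p => (p.1, p.2.2, p.2.1)) (fun p => (p.1, p.2.2, p.2.1)) ?_ ?_ ?_ ?_ ?_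
  all_goals rintro ⟨x, d, e⟩ h
  all_goals simp_all [mem_SS, mul_comm]

lemma sum_TT (n : ℤ) : ∑ p ∈ SS n, TT p.1 p.2.1 p.2.2 = 0 := by
  simp only [TT, Finset.sum_sub_distrib]
  rw [sub_eq_zero]
  have e1 : ∑ p ∈ SS n, (1 - p.2.1 % 2) * GG p.1 p.2.1 p.2.2
      = ∑ p ∈ (SS n).filter (fun p => p.2.1 % 2 = 0), GG p.1 p.2.1 p.2.2 := by
    rw [Finset.sum_filter]
    refine Finset.sum_congr rfl fun p _ => ?_
    rcases Int.emod_two_eq_zero_or_one p.2.1 with h | h <;> simp [h]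
  have e2 : ∑ p ∈ SS n, (1 - p.2.2 % 2) * GG2 p.1 p.2.1 p.2.2
      = ∑ p ∈ (SS n).filter (fun p => p.2.2 % 2 = 0), GG2 p.1 p.2.1 p.2.2 := by
    rw [Finset.sum_filter]
    refine Finset.sum_congr rfl fun p _ => ?_
    rcases Int.emod_two_eq_zero_or_one p.2.2 with h | h <;> simp [h]
  rw [e1, e2]
  refine Finset.sum_nbij' (fun p => (p.1, p.2.1 / 2, 2 * p.2.2))
    (fun p => (p.1, 2 * p.2.1, p.2.2 / 2)) ?_ ?_ ?_ ?_ ?_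
  all_goals rintro ⟨x, d, e⟩ h
  all_goals simp only [Finset.mem_filter, mem_SS] at h ⊢
  all_goals obtain ⟨⟨h1, h2, h3⟩, h4⟩ := h
  · obtain ⟨d, rfl⟩ := Int.dvd_of_emod_eq_zero h4
    rw [Int.mul_ediv_cancel_left _ (by norm_num)]
    refine ⟨⟨by omega, by omega, by linarith⟩, by omega⟩
  · obtain ⟨e, rfl⟩ := Int.dvd_of_emod_eq_zero h4
    rw [Int.mul_ediv_cancel_left _ (by norm_num)]
    refine ⟨⟨by omega, by omega, by linarith⟩, by omega⟩
  · simp only [Prod.mk.injEq, true_and]; omega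
  · simp only [Prod.mk.injEq, true_and]; omega
  · obtain ⟨d, rfl⟩ := Int.dvd_of_emod_eq_zero h4
    rw [Int.mul_ediv_cancel_left _ (by norm_num)]
    simp only [GG, GG2]; ring

lemma sum_HH_eq (n : ℤ) :
    ∑ p ∈ SS n, HH p.1 p.2.1 p.2.2 = 560 * ∑ p ∈ SS n, WW p.1 p.2.1 p.2.2 := by
  have h1 := sum_SS_iota n HH
  have h2 := sum_SS_swap n WW
  have h3 := sum_SS_swap n TT
  have h4 := sum_TT n
  have h5 : ∑ p ∈ SS n, (HH p.1 p.2.1 p.2.2 + HH (-p.1) p.2.1 p.2.2) = _ :=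
    Finset.sum_congr rfl fun p _ => HH_sym p.1 p.2.1 p.2.2
  simp only [Finset.sum_add_distrib, ← Finset.mul_sum] at h5
  linarith

lemma sum_HH_bdry (n : ℤ) :
    ∑ p ∈ SS n, HH p.1 p.2.1 p.2.2 =
      ∑ p ∈ (SS n).filter (fun p => p.2.1 = 2 * p.1 + p.2.2), HH p.1 p.2.1 p.2.2 := by
  have hA : ∑ p ∈ (SS n).filter (fun p => 2 * p.1 + p.2.2 < p.2.1), HH p.1 p.2.1 p.2.2 = 0 := by
    have : ∑ p ∈ (SS n).filter (fun p => 2 * p.1 + p.2.2 < p.2.1), HH p.1 p.2.1 p.2.2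
        = ∑ p ∈ (SS n).filter (fun p => 2 * p.1 + p.2.2 < p.2.1), - HH p.1 p.2.1 p.2.2 := by
      refine Finset.sum_nbij' (fun p => (-p.1 - p.2.2, p.2.1 - 2 * p.1 - p.2.2, p.2.2))
        (fun p => (-p.1 - p.2.2, p.2.1 - 2 * p.1 - p.2.2, p.2.2)) ?_ ?_ ?_ ?_ ?_
      all_goals rintro ⟨x, d, e⟩ h
      all_goals simp only [Finset.mem_filter, mem_SS, Prod.mk.injEq] at h ⊢
      · exact ⟨⟨by omega, by omega, by linarith [h.1.2.2]⟩, by omega⟩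
      · exact ⟨⟨by omega, by omega, by linarith [h.1.2.2]⟩, by omega⟩
      · refine ⟨by ring, by ring, trivial⟩
      · refine ⟨by ring, by ring, trivial⟩
      · rw [HH_phi]; ring
    rw [Finset.sum_neg_distrib] at this
    omega
  have hB : ∑ p ∈ (SS n).filter (fun p => p.2.1 < 2 * p.1 + p.2.2), HH p.1 p.2.1 p.2.2 = 0 := by
    rw [← hA]
    refine Finset.sum_nbij' (fun p => (-p.1, p.2.2, p.2.1)) (fun p => (-p.1, p.2.2, p.2.1))
      ?_ ?_ ?_ ?_ ?_
    all_goals rintro ⟨x, d, e⟩ h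
    all_goals simp only [Finset.mem_filter, mem_SS, Prod.mk.injEq] at h ⊢
    · exact ⟨⟨by omega, by omega, by linarith [h.1.2.2]⟩, by omega⟩
    · exact ⟨⟨by omega, by omega, by linarith [h.1.2.2]⟩, by omega⟩
    · simp
    · simp
    · rw [HH_sigma]
  rw [Finset.sum_filter] at hA hB ⊢
  have hsplit : ∑ p ∈ SS n, HH p.1 p.2.1 p.2.2 =
      ∑ p ∈ SS n, ((if p.2.1 = 2 * p.1 + p.2.2 then HH p.1 p.2.1 p.2.2 else 0)
        + ((if 2 * p.1 + p.2.2 < p.2.1 then HH p.1 p.2.1 p.2.2 else 0)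
        + (if p.2.1 < 2 * p.1 + p.2.2 then HH p.1 p.2.1 p.2.2 else 0))) := by
    refine Finset.sum_congr rfl fun p _ => ?_
    split_ifs <;> first | omega | simp
  rw [hsplit, Finset.sum_add_distrib, Finset.sum_add_distrib, hA, hB, add_zero, add_zero]

lemma telescope (Q : ℤ → ℤ) (a b : ℤ) (h : a ≤ b) :
    ∑ x ∈ Finset.Ico a b, (Q (x + 1) - Q x) = Q b - Q a := by
  induction b, h using Int.le_induction with
  | base => simp
  | succ b hb ih =>
    rw [← Finset.insert_Ico_right_eq_Ico_add_one hb, Finset.sum_insert (by simp), ih]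
    ring

lemma bdry_square (m : ℤ) (hm : 0 < m) :
    ∑ p ∈ (SS (m ^ 2)).filter (fun p => p.2.1 = 2 * p.1 + p.2.2), HH p.1 p.2.1 p.2.2
      = 560 * m ^ 2 := by
  rw [← QQ_end, ← telescope (QQ m) (-m + 1) m (by omega)]
  refine Finset.sum_nbij' (fun p => p.1) (fun x => (x, m + x, m - x)) ?_ ?_ ?_ ?_ ?_
  · rintro ⟨x, d, e⟩ h
    simp only [Finset.mem_filter, mem_SS, Finset.mem_Ico] at h ⊢
    obtain ⟨⟨h1, h2, h3⟩, h4⟩ := h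
    have h5 := abs_lt_of_sq_lt_sq (a := x) (b := m) (by nlinarith [mul_pos h1 h2]) hm.le
    rw [abs_lt] at h5
    omega
  · intro x h
    simp only [Finset.mem_filter, mem_SS, Finset.mem_Ico] at h ⊢
    exact ⟨⟨by omega, by omega, by ring⟩, by ring⟩
  · rintro ⟨x, d, e⟩ h
    simp only [Finset.mem_filter, mem_SS, Prod.mk.injEq, true_and] at h ⊢
    obtain ⟨⟨h1, h2, h3⟩, h4⟩ := h
    subst h4
    have : (x + e) ^ 2 = m ^ 2 := by linarith
    rcases sq_eq_sq_iff_eq_or_eq_neg.1 this with h | h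
    · omega
    · omega
  · intro x h; rfl
  · rintro ⟨x, d, e⟩ h
    simp only [Finset.mem_filter, mem_SS] at h ⊢
    obtain ⟨⟨h1, h2, h3⟩, h4⟩ := h
    subst h4
    have : (x + e) ^ 2 = m ^ 2 := by linarith
    rw [← HH_bdry]
    rcases sq_eq_sq_iff_eq_or_eq_neg.1 this with h | h
    · congr 1 <;> omega
    · omega

open Finset in
noncomputable def PP (k : ℤ) : Finset (ℤ × ℤ) := (Icc 1 k ×ˢ Icc 1 k).filter (fun p => p.1 * p.2 = k)

lemma mem_PP (k d e : ℤ) : (d, e) ∈ PP k ↔ 0 < d ∧ 0 < e ∧ d * e = k := by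
  simp only [PP, Finset.mem_filter, Finset.mem_product, Finset.mem_Icc]
  constructor
  · rintro ⟨⟨h1, h2⟩, h⟩
    exact ⟨by omega, by omega, h⟩
  · rintro ⟨h1, h2, h⟩
    refine ⟨⟨⟨?_, ?_⟩, ?_, ?_⟩, h⟩ <;> nlinarith [mul_pos h1 h2]

noncomputable def tt (k : ℤ) : ℤ := ∑ p ∈ PP k, sg p.1 p.2 * p.1 ^ 3

noncomputable def ss (k : ℤ) : ℤ := (if k = 0 then 1 else 0) + 16 * tt k

lemma sum_tt (n : ℤ) :
    ∑ x ∈ Finset.Icc (-n) n, (n - 9 * x ^ 2) * tt (n - x ^ 2) =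
      ∑ p ∈ SS n, WW p.1 p.2.1 p.2.2 := by
  simp only [tt, Finset.mul_sum]
  rw [Finset.sum_sigma']
  refine Finset.sum_nbij' (fun p => (p.1, p.2.1, p.2.2)) (fun p => ⟨p.1, p.2.1, p.2.2⟩)
    ?_ ?_ ?_ ?_ ?_
  · rintro ⟨x, d, e⟩ h
    simp only [Finset.mem_sigma, mem_PP, mem_SS] at h ⊢
    exact ⟨h.2.1, h.2.2.1, by linarith [h.2.2.2]⟩
  · rintro ⟨x, d, e⟩ h
    have h' := h
    simp only [SS, Finset.mem_filter, Finset.mem_product] at h'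
    simp only [Finset.mem_sigma, mem_PP, mem_SS] at h ⊢
    exact ⟨h'.1.1, h.1, h.2.1, by linarith [h.2.2]⟩
  · rintro ⟨x, d, e⟩ h; rfl
  · rintro ⟨x, d, e⟩ h; rfl
  · rintro ⟨x, d, e⟩ h
    simp only [Finset.mem_sigma, mem_PP] at h ⊢
    rw [WW, h.2.2.2]
    ring

lemma ss_rec (n : ℤ) (hn : 0 < n) :
    ∑ x ∈ Finset.Icc (-n) n, (n - 9 * x ^ 2) * ss (n - x ^ 2) = 0 := by
  have h1 : ∑ x ∈ Finset.Icc (-n) n, (n - 9 * x ^ 2) * ss (n - x ^ 2)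
      = ∑ x ∈ (Finset.Icc (-n) n).filter (fun x => n - x ^ 2 = 0), (n - 9 * x ^ 2)
        + 16 * ∑ x ∈ Finset.Icc (-n) n, (n - 9 * x ^ 2) * tt (n - x ^ 2) := by
    rw [Finset.sum_filter, Finset.mul_sum, ← Finset.sum_add_distrib]
    refine Finset.sum_congr rfl fun x _ => ?_
    rw [ss]
    split_ifs <;> ring
  rw [h1, sum_tt]
  have h2 := sum_HH_eq n
  rw [sum_HH_bdry] at h2
  by_cases hs : ∃ m : ℤ, 0 < m ∧ n = m ^ 2
  · obtain ⟨m, hm, rfl⟩ := hs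
    rw [bdry_square m hm] at h2
    have h3 : (Finset.Icc (-m ^ 2) (m ^ 2)).filter (fun x => m ^ 2 - x ^ 2 = 0) = {m, -m} := by
      ext x
      simp only [Finset.mem_filter, Finset.mem_Icc, Finset.mem_insert, Finset.mem_singleton]
      rw [sub_eq_zero, eq_comm (a := m ^ 2), sq_eq_sq_iff_eq_or_eq_neg]
      constructor
      · exact fun h => h.2
      · intro h
        refine ⟨?_, h⟩
        rcases h with rfl | rfl <;> constructor <;> nlinarith
    rw [h3, Finset.sum_pair (by omega)]
    linarith
  · have hs' : ∀ x : ℤ, x ^ 2 ≠ n := by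
      intro x hx
      apply hs
      refine ⟨|x|, abs_pos.2 ?_, by rw [sq_abs, hx]⟩
      rintro rfl
      simp at hx
      omega
    have h3 : (Finset.Icc (-n) n).filter (fun x => n - x ^ 2 = 0) = ∅ := by
      refine Finset.filter_eq_empty_iff.2 fun x _ h => hs' x (by linarith)
    have h4 : (SS n).filter (fun p => p.2.1 = 2 * p.1 + p.2.2) = ∅ := by
      refine Finset.filter_eq_empty_iff.2 ?_
      rintro ⟨x, d, e⟩ h h'
      simp only [mem_SS] at h h'
      subst h'
      exact hs' (x + e) (by linarith [h.2.2])
    rw [h4, Finset.sum_empty] at h2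
    rw [h3, Finset.sum_empty]
    linarith

/-- Integer vectors with given sum of squares. -/
noncomputable def RR (r : ℕ) (k : ℤ) : Finset (Fin r → ℤ) :=
  (Fintype.piFinset (fun _ => Finset.Icc (-k) k)).filter (fun z => ∑ i, z i ^ 2 = k)

lemma mem_RR (r : ℕ) (k : ℤ) (z : Fin r → ℤ) : z ∈ RR r k ↔ ∑ i, z i ^ 2 = k := by
  simp only [RR, Finset.mem_filter, Fintype.mem_piFinset, Finset.mem_Icc, and_iff_right_iff_imp]
  intro h i
  have h1 : z i ^ 2 ≤ k := by
    rw [← h]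
    exact Finset.single_le_sum (f := fun i => z i ^ 2) (fun i _ => sq_nonneg _) (Finset.mem_univ i)
  have := Int.le_self_sq (z i)
  have := Int.le_self_sq (-z i)
  constructor <;> nlinarith

lemma RR_rec (n : ℤ) :
    ∑ x ∈ Finset.Icc (-n) n, (n - 9 * x ^ 2) * ((RR 8 (n - x ^ 2)).card : ℤ) = 0 := by
  have h1 : ∀ i : Fin 9, ∑ z ∈ RR 9 n, z i ^ 2 = ∑ z ∈ RR 9 n, z 0 ^ 2 := by
    intro i
    refine Finset.sum_nbij' (fun z => z ∘ Equiv.swap 0 i) (fun z => z ∘ Equiv.swap 0 i)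
      ?_ ?_ ?_ ?_ ?_
    · intro z h
      rw [mem_RR] at h ⊢
      rw [← h]
      exact Equiv.sum_comp (Equiv.swap 0 i) (fun j => z j ^ 2)
    · intro z h
      rw [mem_RR] at h ⊢
      rw [← h]
      exact Equiv.sum_comp (Equiv.swap 0 i) (fun j => z j ^ 2)
    · intro z _; ext j; simp
    · intro z _; ext j; simp
    · intro z _; simp
  have h2 : ∑ z ∈ RR 9 n, (n - 9 * z 0 ^ 2) = 0 := by
    have h3 : ∑ z ∈ RR 9 n, ∑ i, z i ^ 2 = ∑ z ∈ RR 9 n, n :=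
      Finset.sum_congr rfl fun z hz => (mem_RR _ _ _).1 hz
    rw [Finset.sum_comm, Finset.sum_congr rfl fun i _ => h1 i] at h3
    rw [Finset.sum_sub_distrib, ← h3, ← Finset.mul_sum]
    simp
  rw [← h2, ← Finset.sum_fiberwise_of_maps_to (s := RR 9 n) (t := Finset.Icc (-n) n)
    (g := fun z => z 0)]
  · refine Finset.sum_congr rfl fun x _ => ?_
    have h4 : ∑ z ∈ (RR 9 n).filter (fun z => z 0 = x), (n - 9 * z 0 ^ 2)
        = ∑ z ∈ (RR 9 n).filter (fun z => z 0 = x), (n - 9 * x ^ 2) :=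
      Finset.sum_congr rfl fun z hz => by rw [(Finset.mem_filter.1 hz).2]
    rw [h4, Finset.sum_const, nsmul_eq_mul, mul_comm]
    congr 2
    refine Finset.card_nbij' (fun y => (Fin.cons x y : Fin 9 → ℤ)) (fun z => Fin.tail z) ?_ ?_ ?_ ?_
    · intro y hy
      have hy := (mem_RR _ _ _).1 (Finset.mem_coe.1 hy)
      simp only [Finset.coe_filter, Set.mem_ofPred_eq, mem_RR]
      rw [Fin.sum_univ_succ]
      simp only [Fin.cons_zero, Fin.cons_succ, hy, and_true]
      ring
    · intro z hz
      simp only [Finset.coe_filter, Set.mem_ofPred_eq, mem_RR] at hz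
      rw [Finset.mem_coe, mem_RR]
      obtain ⟨hz, rfl⟩ := hz
      rw [Fin.sum_univ_succ] at hz
      simp only [Fin.tail]
      linarith
    · intro y _; simp
    · intro z hz
      simp only [Finset.coe_filter, Set.mem_ofPred_eq] at hz
      obtain ⟨_, rfl⟩ := hz
      simp
  · intro z hz
    simp only [RR, Finset.mem_filter, Fintype.mem_piFinset] at hz
    exact hz.1 0

lemma rec_unique (h : ℤ → ℤ) (h0 : ∀ k ≤ 0, h k = 0)
    (hr : ∀ n > 0, ∑ x ∈ Finset.Icc (-n) n, (n - 9 * x ^ 2) * h (n - x ^ 2) = 0) (n : ℕ) :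
    h n = 0 := by
  induction n using Nat.strong_induction_on with
  | _ n ih =>
    rcases Nat.eq_zero_or_pos n with rfl | hn
    · exact h0 _ (by simp)
    have h1 := hr n (by exact_mod_cast hn)
    rw [Finset.sum_eq_single 0] at h1
    · simp at h1
      omega
    · intro x _ hx
      have hx2 : 0 < x ^ 2 := by positivity
      suffices h (n - x ^ 2) = 0 by rw [this, mul_zero]
      rcases le_or_gt ((n : ℤ) - x ^ 2) 0 with h2 | h2
      · exact h0 _ h2
      · obtain ⟨m, hm⟩ := Int.eq_ofNat_of_zero_le h2.le
        rw [hm]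
        exact ih m (by omega)
    · intro h2
      exfalso
      apply h2
      simp

lemma tt_nonpos (k : ℤ) (hk : k ≤ 0) : tt k = 0 := by
  have : PP k = ∅ := by
    ext ⟨d, e⟩
    simp only [mem_PP, Finset.notMem_empty, iff_false]
    rintro ⟨h1, h2, h3⟩
    nlinarith [mul_pos h1 h2]
  rw [tt, this, Finset.sum_empty]

/-- The eight-square theorem. -/
lemma jacobi_eight (n : ℕ) (hn : 0 < n) : ((RR 8 n).card : ℤ) = 16 * tt n := by
  have := rec_unique (fun k => ((RR 8 k).card : ℤ) - ss k) ?_ ?_ n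
  · have h2 : ss n = 16 * tt n := by
      rw [ss, if_neg (by omega), zero_add]
    rw [← h2]; linarith
  · intro k hk
    rw [ss, tt_nonpos k hk]
    rcases hk.lt_or_eq with h | rfl
    · have : RR 8 k = ∅ := by
        ext z
        simp only [mem_RR, Finset.notMem_empty, iff_false]
        intro h'
        have : 0 ≤ ∑ i, z i ^ 2 := Finset.sum_nonneg fun i _ => sq_nonneg _
        omega
      rw [this, if_neg h.ne]; simp
    · have : RR 8 0 = {0} := by
        ext z
        simp only [mem_RR, Finset.mem_singleton]
        rw [Finset.sum_eq_zero_iff_of_nonneg (fun i _ => sq_nonneg _)]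
        constructor
        · intro h; ext i; simpa using h i (Finset.mem_univ i)
        · rintro rfl; simp
      rw [this]; simp
  · intro k hk
    simp only [mul_sub]
    rw [Finset.sum_sub_distrib, RR_rec, ss_rec k hk, sub_zero]

lemma tt_lower (k : ℤ) (hk : 0 < k) : 7 * k ^ 3 ≤ 8 * tt k := by
  rcases Int.emod_two_eq_zero_or_one k with hp | hp
  · have h1 : tt k = ∑ p ∈ (PP k).filter (fun p => p.1 % 2 = 0), p.1 ^ 3
        - ∑ p ∈ (PP k).filter (fun p => p.1 % 2 = 1), p.1 ^ 3 := by
      rw [tt, Finset.sum_filter, Finset.sum_filter, ← Finset.sum_sub_distrib]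
      refine Finset.sum_congr rfl ?_
      rintro ⟨d, e⟩ h
      rw [mem_PP] at h
      simp only [sg]
      rcases Int.emod_two_eq_zero_or_one d with h' | h'
      · simp [h']
      · have : e % 2 = 0 := by
          have h3 := h.2.2
          rcases Int.emod_two_eq_zero_or_one e with h4 | h4
          · exact h4
          · rw [← h3, Int.mul_emod, h', h4] at hp
            norm_num at hp
        simp [h', this]
    have h2 : 8 * ∑ p ∈ (PP k).filter (fun p => p.1 % 2 = 1), p.1 ^ 3 ≤
        ∑ p ∈ (PP k).filter (fun p => p.1 % 2 = 0), p.1 ^ 3 := by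
      have h3 : 8 * ∑ p ∈ (PP k).filter (fun p => p.1 % 2 = 1), p.1 ^ 3
        = ∑ p ∈ (PP k).filter (fun p => p.1 % 2 = 0 ∧ p.1 % 4 = 2), p.1 ^ 3 := by
        rw [Finset.mul_sum]
        refine Finset.sum_nbij' (fun p => (2 * p.1, p.2 / 2)) (fun p => (p.1 / 2, 2 * p.2))
          ?_ ?_ ?_ ?_ ?_
        all_goals rintro ⟨d, e⟩ h
        all_goals simp only [Finset.mem_filter, mem_PP, Prod.mk.injEq] at h ⊢
        all_goals obtain ⟨⟨h1, h2, h3⟩, h4⟩ := h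
        · have : e % 2 = 0 := by
            rcases Int.emod_two_eq_zero_or_one e with h5 | h5
            · exact h5
            · rw [← h3, Int.mul_emod, h4, h5] at hp
              norm_num at hp
          obtain ⟨e, rfl⟩ := Int.dvd_of_emod_eq_zero this
          rw [Int.mul_ediv_cancel_left _ (by norm_num)]
          exact ⟨⟨by omega, by omega, by linarith⟩, by omega, by omega⟩
        · obtain ⟨d, rfl⟩ := Int.dvd_of_emod_eq_zero h4.1
          rw [Int.mul_ediv_cancel_left _ (by norm_num)]
          exact ⟨⟨by omega, by omega, by linarith⟩, by omega⟩
        · have : e % 2 = 0 := by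
            rcases Int.emod_two_eq_zero_or_one e with h5 | h5
            · exact h5
            · rw [← h3, Int.mul_emod, h4, h5] at hp
              norm_num at hp
          omega
        · omega
        · ring
      rw [h3]
      refine Finset.sum_le_sum_of_subset_of_nonneg ?_ ?_
      · intro p hp
        rw [Finset.mem_filter] at hp ⊢
        exact ⟨hp.1, hp.2.1⟩
      · rintro ⟨d, e⟩ h _
        rw [Finset.mem_filter, mem_PP] at h
        exact pow_nonneg h.1.1.le 3
    have h4 : k ^ 3 ≤ ∑ p ∈ (PP k).filter (fun p => p.1 % 2 = 0), p.1 ^ 3 := by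
      refine Finset.single_le_sum (f := fun p : ℤ × ℤ => p.1 ^ 3) (a := (k, 1)) ?_ ?_
      · rintro ⟨d, e⟩ h
        rw [Finset.mem_filter, mem_PP] at h
        exact pow_nonneg h.1.1.le 3
      · rw [Finset.mem_filter, mem_PP]
        simp [hk, hp]
    linarith
  · have h1 : tt k = ∑ p ∈ PP k, p.1 ^ 3 := by
      refine Finset.sum_congr rfl ?_
      rintro ⟨d, e⟩ h
      rw [mem_PP] at h
      have : e % 2 = 1 := by
        rcases Int.emod_two_eq_zero_or_one e with h5 | h5
        · rw [← h.2.2, Int.mul_emod, h5] at hp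
          norm_num at hp
        · exact h5
      simp [sg, this]
    have h4 : k ^ 3 ≤ ∑ p ∈ PP k, p.1 ^ 3 := by
      refine Finset.single_le_sum (f := fun p : ℤ × ℤ => p.1 ^ 3) (a := (k, 1)) ?_ ?_
      · rintro ⟨d, e⟩ h
        rw [mem_PP] at h
        exact pow_nonneg h.1.le 3
      · rw [mem_PP]
        simp [hk]
    have : 0 < k ^ 3 := by positivity
    linarith

lemma choose_bound (k : ℕ) (hk : 0 < k) : Nat.choose (k + 3) 3 ≤ 14 * k ^ 3 := by
  have h : Nat.choose (k + 3) 3 ≤ (k + 3) ^ 3 / Nat.factorial 3 := by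
    have := Nat.choose_le_pow_div (α := ℚ) 3 (k + 3)
    rw [Nat.le_div_iff_mul_le (by decide)]
    rw [le_div_iff₀ (by positivity)] at this
    exact_mod_cast this
  refine h.trans ?_
  refine Nat.div_le_of_le_mul ?_
  have h2 : (k + 3) ^ 3 ≤ (4 * k) ^ 3 := Nat.pow_le_pow_left (by omega) 3
  refine h2.trans ?_
  have : Nat.factorial 3 = 6 := rfl
  rw [this, mul_pow]
  nlinarith [Nat.zero_le (k ^ 3)]

/-- For every positive integer `k`, the number of integer vectors `z ∈ ℤ^8` with
`z₁² + ⋯ + z₈² = k` is at least `(k + 3).choose 3`; in fact it is at least `14k³`. -/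
theorem eight_squares_lower (k : ℕ) (hk : 0 < k) :
    {z : Fin 8 → ℤ | ∑ i, (z i) ^ 2 = (k : ℤ)}.Finite ∧
      Nat.choose (k + 3) 3 ≤ {z : Fin 8 → ℤ | ∑ i, (z i) ^ 2 = (k : ℤ)}.ncard ∧
      14 * k ^ 3 ≤ {z : Fin 8 → ℤ | ∑ i, (z i) ^ 2 = (k : ℤ)}.ncard := by
  have hset : {z : Fin 8 → ℤ | ∑ i, (z i) ^ 2 = (k : ℤ)} = ↑(RR 8 k) := by
    ext z
    simp [mem_RR]
  rw [hset, Set.ncard_coe_finset]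
  have h1 : 14 * k ^ 3 ≤ (RR 8 k).card := by
    have h2 := jacobi_eight k hk
    have h3 := tt_lower k (by exact_mod_cast hk)
    zify
    linarith
  exact ⟨Finset.finite_toSet _, (choose_bound k hk).trans h1, h1⟩
end
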